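/- For n ≥ 4 there are no Jordan copencils in Sⁿ: there is no regular linear subspace L ⊆ Sⁿ of dimension n(n+1)/2 − 2 whose reciprocal variety L⁻¹ is a linear subspace of Sⁿ. -/

import Mathlib

open Matrix

noncomputable section

abbrev Mat (n : ℕ) := Matrix (Fin n) (Fin n) ℂ

/-- The space `Sⁿ` of symmetric `n × n` complex matrices, as a submodule. -/
def symmSub (n : ℕ) : Submodule ℂ (Mat n) where
  carrier := {X : Mat n | X.IsSymm}
  add_mem' := fun ha hb => ha.add hb
  zero_mem' := Matrix.isSymm_zero
  smul_mem' := fun c _ hX => hX.smul c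

/-- The reciprocal variety of a linear subspace `L` of matrices. -/
def recipVar {n : ℕ} (L : Submodule ℂ (Mat n)) : Set (Mat n) :=
  closure {Y : Mat n | ∃ X ∈ L, IsUnit (Matrix.det X) ∧ Y = X⁻¹}

section core
variable {V W : Type*} [AddCommGroup V] [Module ℂ V]
  [AddCommGroup W] [Module ℂ W] [FiniteDimensional ℂ W]

/-- The image of `M` lies in the span of `v, M v` for every non-eigenvector `v`. -/
theorem core_range_le (s : V →ₗ[ℂ] V →ₗ[ℂ] W)
    (hs : ∀ ψ : V →ₗ[ℂ] ℂ, ∃ c : W →ₗ[ℂ] V, ∀ a b, c (s a b) = ψ a • b + ψ b • a)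
    (hsymm : ∀ a b, s a b = s b a) (M : V →ₗ[ℂ] V) (hn : 4 ≤ Module.finrank ℂ V)
    (I : Submodule ℂ W) (hI : Module.finrank ℂ I ≤ 4)
    (h : ∀ a b, s (M a) b + s a (M b) ∈ I) (v : V)
    (hv : LinearIndependent ℂ ![v, M v]) :
    LinearMap.range M ≤ Submodule.span ℂ {v, M v} := by
  set w := M v with hw
  have hvw := LinearIndependent.pair_iff.1 hv
  have hv0 : v ≠ 0 := by
    rintro h0
    have := hvw 1 0 (by simp [h0])
    simp at this
  -- the map φ
  let φ : V →ₗ[ℂ] W := s w + (s v).comp M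
  have hφ : ∀ u, φ u = s w u + s v (M u) := fun u => rfl
  have hwv : w ∉ Submodule.span ℂ {v} := by
    intro hm
    obtain ⟨c, hc⟩ := Submodule.mem_span_singleton.1 hm
    have := hvw c (-1) (by rw [hc]; module)
    simp at this
  obtain ⟨ψ0, hψ0, hψv⟩ := Submodule.exists_le_ker_of_notMem hwv
  have hψv : ψ0 v = 0 := hψv (Submodule.mem_span_singleton_self v)
  have hinj : Function.Injective φ := by
    rw [← LinearMap.ker_eq_bot, LinearMap.ker_eq_bot']
    intro u hu
    obtain ⟨c, hc⟩ := hs ψ0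
    have e1 : ψ0 w • u + ψ0 u • w + ψ0 (M u) • v = 0 := by
      have := congrArg c hu
      rw [hφ, map_add, hc, hc, hψv, map_zero] at this
      rw [← this]; module
    have e2 := congrArg ψ0 e1
    simp only [map_add, map_smul, smul_eq_mul, hψv, map_zero] at e2
    have e3 : ψ0 u = 0 := by
      have : ψ0 w * ψ0 u = 0 := by linear_combination e2 / 2
      exact (mul_eq_zero.1 this).resolve_left hψ0
    rw [e3, zero_smul, add_zero] at e1
    have e4 : u = (-(ψ0 (M u) / ψ0 w)) • v := by
      have : ψ0 w • u = - (ψ0 (M u)) • v := by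
        rw [neg_smul]; exact eq_neg_of_add_eq_zero_left e1
      calc u = (ψ0 w)⁻¹ • ψ0 w • u := by rw [smul_smul, inv_mul_cancel₀ hψ0, one_smul]
        _ = _ := by rw [this, smul_smul]; congr 1; field_simp
    generalize -(ψ0 (M u) / ψ0 w) = d at e4
    subst e4
    have e5 : (2 * d * ψ0 w) • v = 0 := by
      have := congrArg c hu
      rw [hφ, map_add, hc, hc, map_zero, map_smul, map_smul, map_smul, hψv, ← hw] at this
      rw [← this]; simp; module
    rcases smul_eq_zero.1 e5 with h5 | h5
    · have : d = 0 := by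
        rcases mul_eq_zero.1 h5 with h6 | h6
        · simpa using h6
        · exact absurd h6 hψ0
      simp [this]
    · exact absurd h5 hv0
  have hrange : LinearMap.range φ = I := by
    apply Submodule.eq_of_le_of_finrank_le
    · rintro _ ⟨u, rfl⟩
      exact h v u
    · rw [LinearMap.finrank_range_of_inj hinj]; omega
  -- for y outside the span, M y inside
  have key : ∀ y, y ∉ Submodule.span ℂ {v, w} → M y ∈ Submodule.span ℂ {v, w} := by
    intro y hy
    obtain ⟨ψ, hψ, hk⟩ := Submodule.exists_le_ker_of_notMem hy
    have kv : ψ v = 0 := hk (Submodule.subset_span (by simp))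
    have kw : ψ w = 0 := hk (Submodule.subset_span (by simp))
    obtain ⟨c, hc⟩ := hs ψ
    have hyI : s y (M y) ∈ I := by
      have h1 := I.smul_mem (2⁻¹ : ℂ) (h y y)
      rw [hsymm (M y) y] at h1
      convert h1 using 1
      module
    rw [← hrange] at hyI
    obtain ⟨u, hu⟩ := hyI
    have e1 : ψ u • w + ψ (M u) • v = ψ y • M y + ψ (M y) • y := by
      have := congrArg c hu
      rw [hφ, map_add, hc, hc, hc, kv, kw] at this
      rw [← this]; module
    have e2 := congrArg ψ e1
    simp only [map_add, map_smul, smul_eq_mul, kv, kw] at e2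
    have e3 : ψ (M y) = 0 := by
      have : ψ y * ψ (M y) = 0 := by linear_combination - e2 / 2
      exact (mul_eq_zero.1 this).resolve_left hψ
    rw [e3, zero_smul, add_zero] at e1
    rw [← Submodule.smul_mem_iff _ hψ, ← e1]
    exact add_mem (Submodule.smul_mem _ _ (Submodule.subset_span (by simp)))
      (Submodule.smul_mem _ _ (Submodule.subset_span (by simp)))
  have hne : ∃ z, z ∉ Submodule.span ℂ {v, w} := by
    by_contra! hcon
    have htop : Submodule.span ℂ {v, w} = ⊤ := by
      rw [eq_top_iff]; intro x _; exact hcon x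
    have h2 : Module.finrank ℂ (Submodule.span ℂ ({v, w} : Set V)) ≤ 2 := by
      classical
      have := finrank_span_finset_le_card (R := ℂ) ({v, w} : Finset V)
      simp only [Finset.coe_insert, Finset.coe_singleton] at this
      exact this.trans Finset.card_le_two
    rw [htop, finrank_top] at h2
    omega
  obtain ⟨z, hz⟩ := hne
  rintro _ ⟨y, rfl⟩
  by_cases hy : y ∈ Submodule.span ℂ {v, w}
  · have h1 := key z hz
    have h2 := key (y + z) (fun hh => hz (by simpa using sub_mem hh hy))
    rw [map_add] at h2
    simpa using sub_mem h2 h1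
  · exact key y hy

theorem core [FiniteDimensional ℂ V] (s : V →ₗ[ℂ] V →ₗ[ℂ] W)
    (hs : ∀ ψ : V →ₗ[ℂ] ℂ, ∃ c : W →ₗ[ℂ] V, ∀ a b, c (s a b) = ψ a • b + ψ b • a)
    (hsymm : ∀ a b, s a b = s b a) (M : V →ₗ[ℂ] V) (hn : 4 ≤ Module.finrank ℂ V)
    (I : Submodule ℂ W) (hI : Module.finrank ℂ I ≤ 4)
    (h : ∀ a b, s (M a) b + s a (M b) ∈ I) :
    (∃ c : ℂ, ∀ x, M x = c • x) ∨ Module.finrank ℂ (LinearMap.range M) ≤ 1 := by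
  by_contra! hcon
  obtain ⟨hns, hr⟩ := hcon
  have hex : ∃ v, LinearIndependent ℂ ![v, M v] := by
    by_contra! hall
    obtain ⟨c, hc⟩ := LinearMap.exists_eq_smul_id_of_forall_notLinearIndependent
      (f := M) hall
    obtain ⟨x, hx⟩ := hns c
    exact hx (by rw [hc]; simp)
  have two : ∀ v, Module.finrank ℂ (Submodule.span ℂ ({v, M v} : Set V)) ≤ 2 := by
    intro v
    classical
    have := finrank_span_finset_le_card (R := ℂ) ({v, M v} : Finset V)
    simp only [Finset.coe_insert, Finset.coe_singleton] at this
    exact this.trans Finset.card_le_two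
  have heq : ∀ v, LinearIndependent ℂ ![v, M v] →
      LinearMap.range M = Submodule.span ℂ {v, M v} := by
    intro v hv
    apply Submodule.eq_of_le_of_finrank_le (core_range_le s hs hsymm M hn I hI h v hv)
    have := two v
    omega
  have hmem : ∀ v, LinearIndependent ℂ ![v, M v] → v ∈ LinearMap.range M := by
    intro v hv
    rw [heq v hv]
    exact Submodule.subset_span (by simp)
  obtain ⟨v, hv⟩ := hex
  have hker : ∀ e, e ∉ LinearMap.range M → M e = 0 := by
    intro e he
    have h1 : ¬ LinearIndependent ℂ ![e, M e] := fun hh => he (hmem e hh)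
    have he0 : e ≠ 0 := by rintro rfl; exact he (zero_mem _)
    rw [LinearIndependent.pair_iff' he0] at h1
    push Not at h1
    obtain ⟨a, ha⟩ := h1
    by_cases ha0 : a = 0
    · rw [← ha, ha0, zero_smul]
    · exfalso
      apply he
      refine ⟨a⁻¹ • e, ?_⟩
      rw [map_smul, ← ha, smul_smul, inv_mul_cancel₀ ha0, one_smul]
  have hne : ∃ z, z ∉ LinearMap.range M := by
    by_contra! hcon
    have htop : LinearMap.range M = ⊤ := by
      rw [eq_top_iff]; intro x _; exact hcon x
    have h2 := two v
    rw [← heq v hv, htop, finrank_top] at h2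
    omega
  obtain ⟨z, hz⟩ := hne
  have h1 := hker z hz
  have h2 := hker (v + z) (fun hh => hz (by simpa using sub_mem hh (hmem v hv)))
  rw [map_add, h1, add_zero] at h2
  have := LinearIndependent.pair_iff.1 hv 0 1 (by simp [h2])
  simp at this
end core

theorem finrank_symmSub (n : ℕ) : Module.finrank ℂ (symmSub n) = n * (n + 1) / 2 := by
  let e : (Sym2 (Fin n) → ℂ) ≃ₗ[ℂ] symmSub n :=
    { toFun := fun f => ⟨Matrix.of fun i j => f s(i, j), by
        apply Matrix.IsSymm.ext; intro i j; simp [Sym2.eq_swap]⟩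
      map_add' := by intro f g; ext i j; simp
      map_smul' := by intro c f; ext i j; simp
      invFun := fun X z => Sym2.lift ⟨fun i j => X.1 i j, fun i j => by
        exact (Matrix.IsSymm.apply X.2 i j).symm⟩ z
      left_inv := by
        intro f; funext z
        induction z with
        | _ i j => simp
      right_inv := by intro X; ext i j; simp }
  rw [← e.finrank_eq, Module.finrank_fintype_fun_eq_card, Sym2.card, Fintype.card_fin,
    Nat.choose_two_right]
  simp [mul_comm]

/-- symmetric product of vectors -/
def sprod (n : ℕ) : (Fin n → ℂ) →ₗ[ℂ] (Fin n → ℂ) →ₗ[ℂ] Mat n :=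
  LinearMap.mk₂ ℂ (fun a b => vecMulVec a b + vecMulVec b a)
    (by intros; simp [add_vecMulVec, vecMulVec_add]; abel)
    (by intros; simp [smul_vecMulVec, vecMulVec_smul])
    (by intros; simp [add_vecMulVec, vecMulVec_add]; abel)
    (by intros; simp [smul_vecMulVec, vecMulVec_smul])

theorem sprod_apply {n : ℕ} (a b : Fin n → ℂ) :
    sprod n a b = vecMulVec a b + vecMulVec b a := rfl

theorem sprod_symm {n : ℕ} (a b : Fin n → ℂ) : sprod n a b = sprod n b a := by
  rw [sprod_apply, sprod_apply, add_comm]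

theorem sprod_mem {n : ℕ} (a b : Fin n → ℂ) : sprod n a b ∈ symmSub n := by
  change (sprod n a b)ᵀ = _
  rw [sprod_apply, transpose_add, transpose_vecMulVec, transpose_vecMulVec, add_comm]

theorem sprod_contract {n : ℕ} (ψ : (Fin n → ℂ) →ₗ[ℂ] ℂ) :
    ∃ c : Mat n →ₗ[ℂ] (Fin n → ℂ), ∀ a b, c (sprod n a b) = ψ a • b + ψ b • a := by
  let q : Fin n → ℂ := fun i => ψ (Pi.single i 1)
  have hq : ∀ a, ψ a = a ⬝ᵥ q := by
    intro a
    conv_lhs => rw [pi_eq_sum_univ' a]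
    simp [dotProduct, q, Pi.single]
  refine ⟨(Matrix.mulVecBilin ℂ ℂ).flip q, ?_⟩
  intro a b
  have : ∀ X : Mat n, (Matrix.mulVecBilin ℂ ℂ).flip q X = X *ᵥ q := fun _ => rfl
  rw [this, sprod_apply, add_mulVec, hq, hq]
  ext i
  simp [vecMulVec_mulVec]
  ring

theorem exists_shift {n : ℕ} (A X : Mat n) (hA : IsUnit A.det) :
    ∃ s : ℂ, IsUnit (X + s • A).det ∧ IsUnit (X + s • A + A).det := by
  set p := (-(A⁻¹ * X)).charpoly with hp
  have hp0 : p ≠ 0 := (Matrix.charpoly_monic _).ne_zero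
  have hdet : ∀ s : ℂ, p.eval s ≠ 0 → IsUnit (X + s • A).det := by
    intro s hs
    have : X + s • A = A * (Matrix.scalar (Fin n) s - (-(A⁻¹ * X))) := by
      rw [sub_neg_eq_add, mul_add, ← mul_assoc, Matrix.mul_nonsing_inv _ hA, one_mul, add_comm]
      congr 1
      ext i j; simp [mul_comm]
    rw [this, det_mul]
    refine hA.mul (isUnit_iff_ne_zero.2 ?_)
    rwa [hp, Matrix.eval_charpoly] at hs
  let p' := p * p.comp (Polynomial.X + Polynomial.C 1)
  have hp' : p' ≠ 0 := by
    refine mul_ne_zero hp0 ?_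
    intro h0
    have := (Polynomial.comp_X_add_C_eq_zero_iff (p := p)).1 h0
    exact hp0 this
  obtain ⟨s, hs⟩ : ∃ s, p'.eval s ≠ 0 := by
    by_contra! hcon
    exact hp' (Polynomial.funext (by simpa using hcon))
  simp only [p', Polynomial.eval_mul, Polynomial.eval_comp, Polynomial.eval_add,
    Polynomial.eval_X, Polynomial.eval_C] at hs
  refine ⟨s, hdet s (left_ne_zero_of_mul hs), ?_⟩
  have := hdet _ (right_ne_zero_of_mul hs)
  rwa [add_smul, one_smul, ← add_assoc] at this

theorem inv_mem_of_mem {n : ℕ} (L M : Submodule ℂ (Mat n)) (h : recipVar L = (M : Set (Mat n)))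
    {Z : Mat n} (hZ : Z ∈ M) : Z⁻¹ ∈ L := by
  have hc : IsClosed {Y : Mat n | Y.adjugate ∈ L} := by
    have : IsClosed (L : Set (Mat n)) := L.closed_of_finiteDimensional
    exact this.preimage (continuous_id.matrix_adjugate)
  have hsub : recipVar L ⊆ {Y : Mat n | Y.adjugate ∈ L} := by
    apply closure_minimal _ hc
    rintro Y ⟨X, hX, hXd, rfl⟩
    have hu : IsUnit (X⁻¹).det := Matrix.isUnit_nonsing_inv_det X hXd
    have h1 : (X⁻¹).adjugate = (X⁻¹).det • X := by
      have h2 : X⁻¹ * X = 1 := Matrix.nonsing_inv_mul _ hXd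
      calc (X⁻¹).adjugate = (X⁻¹).adjugate * (X⁻¹ * X) := by rw [h2, mul_one]
        _ = _ := by rw [← mul_assoc, Matrix.adjugate_mul, Matrix.smul_mul, one_mul]
    change (X⁻¹).adjugate ∈ L
    rw [h1]
    exact L.smul_mem _ hX
  have hZ' : Z.adjugate ∈ L := hsub (by rw [h]; exact hZ)
  rw [Matrix.inv_def]
  exact L.smul_mem _ hZ'

theorem jordan_sq {n : ℕ} (L M : Submodule ℂ (Mat n)) (h : recipVar L = (M : Set (Mat n)))
    {A : Mat n} (hA : A ∈ L) (hd : IsUnit A.det) {X : Mat n} (hX : X ∈ L) :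
    X * A⁻¹ * X ∈ L := by
  have hM : ∀ Y ∈ L, IsUnit Y.det → Y⁻¹ ∈ M := by
    intro Y hY hYd
    have : Y⁻¹ ∈ recipVar L := subset_closure ⟨Y, hY, hYd, rfl⟩
    rw [h] at this
    exact this
  obtain ⟨s, h1, h2⟩ := exists_shift A X hd
  set Y := X + s • A with hYdef
  have hY : Y ∈ L := L.add_mem hX (L.smul_mem _ hA)
  have hZ : Y⁻¹ - (Y + A)⁻¹ ∈ M := M.sub_mem (hM _ hY h1) (hM _ (L.add_mem hY hA) h2)
  have hprod : (Y⁻¹ - (Y + A)⁻¹) * (Y + Y * A⁻¹ * Y) = 1 := by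
    have e1 : Y⁻¹ * Y = 1 := Matrix.nonsing_inv_mul _ h1
    have e2 : (Y + A)⁻¹ * (Y + A) = 1 := Matrix.nonsing_inv_mul _ h2
    have e3 : A * A⁻¹ = 1 := Matrix.mul_nonsing_inv _ hd
    have e4 : Y + Y * A⁻¹ * Y = (Y + A) * (A⁻¹ * Y) := by
      rw [add_mul Y A, ← mul_assoc A, e3, one_mul, add_comm, mul_assoc]
    rw [sub_mul]
    conv_lhs => rw [e4]
    rw [← mul_assoc (Y + A)⁻¹, e2, one_mul, ← e4, mul_add, e1, ← mul_assoc, ← mul_assoc, e1, one_mul]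
    abel
  have h3 := inv_mem_of_mem L M h hZ
  rw [Matrix.inv_eq_right_inv hprod] at h3
  have h4 : Y * A⁻¹ * Y ∈ L := by simpa using L.sub_mem h3 hY
  have e5 : Y * A⁻¹ * Y = X * A⁻¹ * X + (2 * s) • X + (s ^ 2) • A := by
    have e3 : A * A⁻¹ = 1 := Matrix.mul_nonsing_inv _ hd
    have e4 : A⁻¹ * A = 1 := Matrix.nonsing_inv_mul _ hd
    rw [hYdef]
    simp only [add_mul, mul_add, Matrix.smul_mul, Matrix.mul_smul, e3, one_mul]
    rw [mul_assoc X A⁻¹ A, e4, mul_one]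
    module
  have h5 := L.sub_mem (L.sub_mem h4 (L.smul_mem (s ^ 2) hA)) (L.smul_mem (2 * s) hX)
  rw [e5] at h5
  simpa using h5

theorem jordan_mul {n : ℕ} (L M : Submodule ℂ (Mat n)) (h : recipVar L = (M : Set (Mat n)))
    {A : Mat n} (hA : A ∈ L) (hd : IsUnit A.det) {X Y : Mat n} (hX : X ∈ L) (hY : Y ∈ L) :
    X * A⁻¹ * Y + Y * A⁻¹ * X ∈ L := by
  have h1 := L.sub_mem (L.sub_mem (jordan_sq L M h hA hd (L.add_mem hX hY))
    (jordan_sq L M h hA hd hX)) (jordan_sq L M h hA hd hY)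
  convert h1 using 1
  simp only [add_mul, mul_add]
  abel

def trB (n : ℕ) : LinearMap.BilinForm ℂ (symmSub n) :=
  LinearMap.mk₂ ℂ (fun X Y => (X.1 * Y.1).trace)
    (by intros; simp [add_mul]) (by intros; simp)
    (by intros; simp [mul_add]) (by intros; simp)

theorem trB_apply {n : ℕ} (X Y : symmSub n) : trB n X Y = (X.1 * Y.1).trace := rfl

theorem trB_isSymm {n : ℕ} (X Y : symmSub n) : trB n X Y = trB n Y X := by
  rw [trB_apply, trB_apply, Matrix.trace_mul_comm]

open scoped ComplexOrder in
theorem trB_nondeg (n : ℕ) : (trB n).Nondegenerate := by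
  have h : ∀ X : symmSub n, (∀ Y, trB n X Y = 0) → X = 0 := by
    intro X hX
    have hs : X.1ᴴ ∈ symmSub n := by
      change (X.1ᴴ)ᵀ = X.1ᴴ
      have : X.1ᵀ = X.1 := X.2
      ext i j
      have h2 := congrFun (congrFun this i) j
      simp only [Matrix.transpose_apply] at h2
      simp [Matrix.conjTranspose_apply, h2]
    have h1 := hX ⟨_, hs⟩
    rw [trB_apply] at h1
    have := (Matrix.trace_mul_conjTranspose_self_eq_zero_iff).1 h1
    exact Subtype.ext this
  refine ⟨h, ?_⟩
  intro X hX
  exact h X (fun Y => by rw [trB_isSymm]; exact hX Y)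

theorem exists_perp {n : ℕ} (hn : 4 ≤ n) (L : Submodule ℂ (Mat n)) (hL : L ≤ symmSub n)
    (hf : Module.finrank ℂ L = n * (n + 1) / 2 - 2) :
    ∃ P : Submodule ℂ (Mat n), Module.finrank ℂ P = 2 ∧
      ∀ D, D ∈ P ↔ D ∈ symmSub n ∧ ∀ X ∈ L, (D * X).trace = 0 := by
  let L' := L.comap (symmSub n).subtype
  have hL' : Module.finrank ℂ L' = Module.finrank ℂ L :=
    (Submodule.comapSubtypeEquivOfLe hL).finrank_eq
  refine ⟨((trB n).orthogonal L').map (symmSub n).subtype, ?_, ?_⟩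
  · rw [Submodule.finrank_map_subtype_eq, LinearMap.BilinForm.finrank_orthogonal (trB_nondeg n),
      hL', hf, finrank_symmSub]
    have : 4 * 5 ≤ n * (n + 1) := Nat.mul_le_mul hn (by omega)
    omega
  · intro D
    constructor
    · rintro ⟨D, hD, rfl⟩
      refine ⟨D.2, fun X hX => ?_⟩
      have := hD ⟨X, hL hX⟩ hX
      rw [trB_isSymm] at this
      exact this
    · rintro ⟨h1, h2⟩
      refine ⟨⟨D, h1⟩, ?_, rfl⟩
      intro X hX
      rw [trB_isSymm]
      exact h2 _ hX

theorem finrank_map_le {n : ℕ} (hn : 4 ≤ n) (L : Submodule ℂ (Mat n)) (hL : L ≤ symmSub n)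
    (hf : Module.finrank ℂ L = n * (n + 1) / 2 - 2) (P : Submodule ℂ (Mat n))
    (hP : Module.finrank ℂ P = 2) (T : Mat n →ₗ[ℂ] Mat n) (hT : L.map T ≤ P) :
    Module.finrank ℂ ((symmSub n).map T) ≤ 4 := by
  obtain ⟨R, hR⟩ := Submodule.exists_isCompl L
  have hsup : L ⊔ (R ⊓ symmSub n) = symmSub n := by
    rw [← sup_inf_assoc_of_le R hL, hR.sup_eq_top, top_inf_eq]
  have hinf : L ⊓ (R ⊓ symmSub n) = ⊥ := by
    rw [← inf_assoc, hR.inf_eq_bot, bot_inf_eq]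
  have h1 := Submodule.finrank_sup_add_finrank_inf_eq L (R ⊓ symmSub n)
  rw [hsup, hinf, finrank_bot, finrank_symmSub, hf] at h1
  have h0 : 4 * 5 ≤ n * (n + 1) := Nat.mul_le_mul hn (by omega)
  have h2 := Submodule.finrank_map_le T (R ⊓ symmSub n)
  have h3 := Submodule.finrank_mono hT
  have h4 := Submodule.finrank_add_le_finrank_add_finrank (L.map T) ((R ⊓ symmSub n).map T)
  rw [← Submodule.map_sup, hsup] at h4
  omega

theorem quad_rank_one {n : ℕ} (hn : 4 ≤ n) (L M : Submodule ℂ (Mat n)) (hL : L ≤ symmSub n)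
    (hf : Module.finrank ℂ L = n * (n + 1) / 2 - 2)
    (h : recipVar L = (M : Set (Mat n)))
    {A : Mat n} (hA : A ∈ L) (hd : IsUnit A.det)
    (P : Submodule ℂ (Mat n)) (hP : Module.finrank ℂ P = 2)
    (hPm : ∀ D, D ∈ P ↔ D ∈ symmSub n ∧ ∀ X ∈ L, (D * X).trace = 0)
    {D : Mat n} (hD : D ∈ P) (x a : Fin n → ℂ) :
    (x ⬝ᵥ D *ᵥ x) * (a ⬝ᵥ D *ᵥ a) = (x ⬝ᵥ D *ᵥ a) ^ 2 := by
  have e3 : A * A⁻¹ = 1 := Matrix.mul_nonsing_inv _ hd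
  have e4 : A⁻¹ * A = 1 := Matrix.nonsing_inv_mul _ hd
  have hDs : Dᵀ = D := ((hPm D).1 hD).1
  have hAs : Aᵀ = A := hL hA
  have hUs : (A⁻¹)ᵀ = A⁻¹ := by rw [Matrix.transpose_nonsing_inv, hAs]
  let T : Mat n →ₗ[ℂ] Mat n :=
    { toFun := fun X => D * X * A⁻¹ + A⁻¹ * X * D
      map_add' := by intro X Y; simp only [mul_add, add_mul]; abel
      map_smul' := by intro c X; simp }
  have hT : ∀ X, T X = D * X * A⁻¹ + A⁻¹ * X * D := fun _ => rfl
  have hmap : L.map T ≤ P := by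
    rintro _ ⟨X, hX, rfl⟩
    have hXs : Xᵀ = X := hL hX
    rw [hPm, hT]
    refine ⟨?_, fun Y hY => ?_⟩
    · change (D * X * A⁻¹ + A⁻¹ * X * D)ᵀ = _
      simp only [transpose_add, transpose_mul, hXs, hUs, hDs]
      rw [add_comm, mul_assoc, mul_assoc]
    · have := ((hPm D).1 hD).2 _ (jordan_mul L M h hA hd hX hY)
      rw [← this, mul_add, add_mul, trace_add, trace_add]
      congr 1
      · simp only [mul_assoc]
      · rw [mul_assoc (A⁻¹ * X), Matrix.trace_mul_comm]; simp only [mul_assoc]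
  have hI := finrank_map_le hn L hL hf P hP T hmap
  have hsT : ∀ a b, sprod n (Matrix.mulVecLin (D * A) a) b + sprod n a (Matrix.mulVecLin (D * A) b)
      ∈ (symmSub n).map T := by
    intro a b
    refine ⟨sprod n (A *ᵥ a) (A *ᵥ b), sprod_mem _ _, ?_⟩
    have k1 : ∀ v, (A *ᵥ v) ᵥ* A⁻¹ = v := by
      intro v
      rw [← Matrix.mulVec_transpose, hUs, Matrix.mulVec_mulVec, e4, Matrix.one_mulVec]
    have k2 : ∀ v, A⁻¹ *ᵥ (A *ᵥ v) = v := by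
      intro v
      rw [Matrix.mulVec_mulVec, e4, Matrix.one_mulVec]
    have k3 : ∀ v, (A *ᵥ v) ᵥ* D = D *ᵥ (A *ᵥ v) := by
      intro v
      rw [← Matrix.mulVec_transpose, hDs]
    rw [hT]
    simp only [sprod_apply, Matrix.mulVecLin_apply, ← Matrix.mulVec_mulVec, mul_add, add_mul,
      Matrix.mul_vecMulVec, Matrix.vecMulVec_mul, k1, k2, k3]
    abel
  rcases core (sprod n) sprod_contract sprod_symm (Matrix.mulVecLin (D * A)) (by simpa using hn)
    _ hI hsT with ⟨c, hc⟩ | hr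
  · have hDA : D * A = c • (1 : Mat n) := by
      apply Matrix.ext_of_mulVec_single
      intro i
      have := hc (Pi.single i 1)
      rw [Matrix.mulVecLin_apply] at this
      rw [this, Matrix.smul_mulVec, Matrix.one_mulVec]
    have ht := ((hPm D).1 hD).2 A hA
    rw [hDA, Matrix.trace_smul, Matrix.trace_one, Fintype.card_fin, smul_eq_mul] at ht
    have hn0 : (n : ℂ) ≠ 0 := by
      have : n ≠ 0 := by omega
      exact_mod_cast this
    have hc0 : c = 0 := (mul_eq_zero.1 ht).resolve_right hn0
    have hD0 : D = 0 := by
      have : D = D * A * A⁻¹ := by rw [mul_assoc, e3, mul_one]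
      rw [this, hDA, hc0]; simp
    simp [hD0]
  · obtain ⟨p, hp⟩ := finrank_le_one_iff.1 hr
    have hr' : ∀ v, ∃ α : ℂ, D *ᵥ v = α • p.1 := by
      intro v
      have hm : D *ᵥ v ∈ LinearMap.range (Matrix.mulVecLin (D * A)) := by
        refine ⟨A⁻¹ *ᵥ v, ?_⟩
        rw [Matrix.mulVecLin_apply, Matrix.mulVec_mulVec, mul_assoc, e3, mul_one]
      obtain ⟨α, hα⟩ := hp ⟨_, hm⟩
      exact ⟨α, (congrArg Subtype.val hα).symm⟩
    have hsw : x ⬝ᵥ D *ᵥ a = a ⬝ᵥ D *ᵥ x := by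
      rw [Matrix.dotProduct_mulVec, ← Matrix.mulVec_transpose, hDs, dotProduct_comm]
    obtain ⟨α, hα⟩ := hr' x
    obtain ⟨β, hβ⟩ := hr' a
    rw [sq]
    nth_rewrite 2 [hsw]
    rw [hα, hβ]
    simp only [dotProduct_smul, smul_eq_mul]
    ring

theorem eq_zero_of_quad {n : ℕ} {D : Mat n} (hD : Dᵀ = D) (h : ∀ x, x ⬝ᵥ D *ᵥ x = 0) : D = 0 := by
  have hsw : ∀ x a, x ⬝ᵥ D *ᵥ a = a ⬝ᵥ D *ᵥ x := by
    intro x a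
    rw [Matrix.dotProduct_mulVec, ← Matrix.mulVec_transpose, hD, dotProduct_comm]
  have h2 : ∀ x a, x ⬝ᵥ D *ᵥ a = 0 := by
    intro x a
    have := h (x + a)
    rw [mulVec_add, dotProduct_add, add_dotProduct, add_dotProduct, h, h, hsw a x] at this
    linear_combination this / 2
  ext i j
  have := h2 (Pi.single i 1) (Pi.single j 1)
  simpa using this

/-- For `n ≥ 4` there are no Jordan copencils in `Sⁿ`: no regular subspace
`L ⊆ Sⁿ` of codimension `2` (dimension `n(n+1)/2 - 2`) has a reciprocal variety
that is a linear space. -/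
theorem stmt12 {n : ℕ} (hn : 4 ≤ n) :
    ¬ ∃ L : Submodule ℂ (Mat n), L ≤ symmSub n ∧
      (∃ X ∈ L, IsUnit (Matrix.det X)) ∧
      Module.finrank ℂ L = n * (n + 1) / 2 - 2 ∧
      ∃ M : Submodule ℂ (Mat n), recipVar L = (M : Set (Mat n)) := by
  rintro ⟨L, hL, ⟨A, hA, hd⟩, hf, M, h⟩
  obtain ⟨P, hP, hPm⟩ := exists_perp hn L hL hf
  have key := fun {D : Mat n} (hD : D ∈ P) (x a : Fin n → ℂ) =>
    quad_rank_one hn L M hL hf h hA hd P hP hPm hD x a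
  have hsy : ∀ D ∈ P, Dᵀ = D := fun D hD => ((hPm D).1 hD).1
  -- a nonzero element
  have hne : P ≠ ⊥ := by rintro rfl; simp at hP
  obtain ⟨D, hD, hD0⟩ := Submodule.exists_mem_ne_zero_of_ne_bot hne
  obtain ⟨x, hx⟩ : ∃ x, x ⬝ᵥ D *ᵥ x ≠ 0 := by
    by_contra! hcon
    exact hD0 (eq_zero_of_quad (hsy D hD) hcon)
  have hspan : ∀ E ∈ P, E = ((x ⬝ᵥ E *ᵥ x) / (x ⬝ᵥ D *ᵥ x)) • D := by
    intro E hE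
    set t := (x ⬝ᵥ E *ᵥ x) / (x ⬝ᵥ D *ᵥ x) with ht
    set B := E - t • D with hB
    have hBP : B ∈ P := P.sub_mem hE (P.smul_mem _ hD)
    have hBx : x ⬝ᵥ B *ᵥ x = 0 := by
      rw [hB, sub_mulVec, dotProduct_sub, smul_mulVec, dotProduct_smul, smul_eq_mul, ht,
        div_mul_cancel₀ _ hx, sub_self]
    have hB0 : B = 0 := by
      apply eq_zero_of_quad (hsy B hBP)
      intro a
      have k1 := key hBP x a
      rw [hBx, zero_mul] at k1
      have k2 : x ⬝ᵥ B *ᵥ a = 0 := by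
        exact pow_eq_zero_iff (two_ne_zero) |>.1 k1.symm
      have k3 := key hD x a
      have k4 := key (P.add_mem hD hBP) x a
      simp only [add_mulVec, dotProduct_add, hBx, k2, add_zero] at k4
      have k5 : (x ⬝ᵥ D *ᵥ x) * (a ⬝ᵥ B *ᵥ a) = 0 := by linear_combination k4 - k3
      exact (mul_eq_zero.1 k5).resolve_left hx
    exact sub_eq_zero.1 hB0
  have : Module.finrank ℂ P ≤ 1 := by
    apply finrank_le_one (⟨D, hD⟩ : P)
    intro E
    exact ⟨_, Subtype.ext (hspan E.1 E.2).symm⟩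
  omega
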